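/- Let X, U ∈ ℝ^{d×p} satisfy XᵀX = I_p, UᵀU = I_p and XᵀU = 0, let V, Q ∈ ℝ^{p×p} be orthogonal matrices, let S = diag(s₁,…,s_p) be a real diagonal matrix with cos(sᵢ) ≠ 0 for all i, and set Y := X V cos(S) Qᵀ + U sin(S) Qᵀ. Then XᵀY is invertible and (Y − X XᵀY)(XᵀY)⁻¹ = U tan(S) Vᵀ. In particular, the right-hand side of the Log-map derivation is independent of the arbitrary orthogonal matrix Q. -/

import Mathlib

open Matrix

/-- If `cos(sᵢ) ≠ 0` for all `i`, then for `Y = X V cos(S) Qᵀ + U sin(S) Qᵀ`,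
the matrix `XᵀY` is invertible and `(Y − X XᵀY)(XᵀY)⁻¹ = U tan(S) Vᵀ`;
in particular this is independent of the orthogonal matrix `Q`. -/
theorem grassmann_log_formula
    {d p : ℕ} (X U : Matrix (Fin d) (Fin p) ℝ)
    (V Q : Matrix (Fin p) (Fin p) ℝ) (s : Fin p → ℝ)
    (hX : Xᵀ * X = 1) (hU : Uᵀ * U = 1) (hXU : Xᵀ * U = 0)
    (hV : Vᵀ * V = 1) (hV' : V * Vᵀ = 1)
    (hQ : Qᵀ * Q = 1) (hQ' : Q * Qᵀ = 1)
    (hcos : ∀ i, Real.cos (s i) ≠ 0) :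
    let Y := X * V * Matrix.diagonal (fun i => Real.cos (s i)) * Qᵀ +
             U * Matrix.diagonal (fun i => Real.sin (s i)) * Qᵀ
    IsUnit (Xᵀ * Y) ∧
      (Y - X * (Xᵀ * Y)) * (Xᵀ * Y)⁻¹ =
        U * Matrix.diagonal (fun i => Real.tan (s i)) * Vᵀ := by
  intro Y
  have hXY : Xᵀ * Y = V * diagonal (fun i => Real.cos (s i)) * Qᵀ := by
    simp only [Y, Matrix.mul_add, ← Matrix.mul_assoc, hX, hXU, Matrix.one_mul, Matrix.zero_mul,
      add_zero]
  have hdiag : diagonal (fun i => Real.cos (s i)) * diagonal (fun i => (Real.cos (s i))⁻¹) =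
      (1 : Matrix (Fin p) (Fin p) ℝ) := by
    simp [diagonal_mul_diagonal, hcos]
  have hinv : V * diagonal (fun i => Real.cos (s i)) * Qᵀ *
      (Q * diagonal (fun i => (Real.cos (s i))⁻¹) * Vᵀ) = 1 := by
    rw [Matrix.mul_assoc Q, Matrix.mul_assoc _ Qᵀ, ← Matrix.mul_assoc Qᵀ, hQ, Matrix.one_mul,
      Matrix.mul_assoc V, ← Matrix.mul_assoc (diagonal _), hdiag, Matrix.one_mul, hV']
  have hres : Y - X * (Xᵀ * Y) = U * diagonal (fun i => Real.sin (s i)) * Qᵀ := by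
    simp only [hXY, Y, ← Matrix.mul_assoc, add_sub_cancel_left]
  rw [hres, hXY]
  refine ⟨IsUnit.of_mul_eq_one _ hinv, ?_⟩
  rw [inv_eq_right_inv hinv, Matrix.mul_assoc Q, Matrix.mul_assoc _ Qᵀ, ← Matrix.mul_assoc Qᵀ,
    hQ, Matrix.one_mul, ← Matrix.mul_assoc, Matrix.mul_assoc U, diagonal_mul_diagonal]
  simp only [Real.tan_eq_sin_div_cos, div_eq_mul_inv]
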